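/- Fix x ∈ 𝒳 with P(X = x) > 0 and suppose: (Randomization) under P(·|S = e, X = x), D is independent of the pair (Y(0), Y(1)); (Positivity) P(S = e, X = x, D = d, Y = y) > 0 and P(S = o, X = x, D = d, Y = y) > 0 for all d, y ∈ {0, 1}; (Stability) R is conditionally independent of S given (X, D, Y). Then for each d ∈ {0, 1}, writing μ(d, x) := E[Y(d) | S = e, X = x], Δ̃ᵉ(d) := 1{D = d, S = e}/P(D = d, S = e | X = x) − 1{Y = 0, D = d, S = o}/P(Y = 0, D = d, S = o | X = x) and Δ̃ᵒ(d) := 1{Y = 1, D = d, S = o}/P(Y = 1, D = d, S = o | X = x) − 1{Y = 0, D = d, S = o}/P(Y = 0, D = d, S = o | X = x), the conditional expectation of Δ̃ᵉ(d) − μ(d, x)·Δ̃ᵒ(d) given σ(R), computed under P_x := P(·|X = x), equals 0 P_x-almost surely. (Here the treatment is allowed to have a direct effect on R; only stability across samples is imposed.) -/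

import Mathlib

open MeasureTheory ProbabilityTheory

noncomputable section

/-- Sample indicator values: experimental (`e`) or observational (`o`). -/
inductive Sample : Type
  | e
  | o
deriving DecidableEq

instance : MeasurableSpace Sample := ⊤

/-- Real-valued indicator of a boolean (`{0,1}`-valued variable). -/
def b2r (b : Bool) : ℝ := if b then 1 else 0

/-- `CondIndepOf P R V W` : the conditional law of `R` given `V = v, W = w` agrees with
the conditional law of `R` given `V = v`, for all values with positive probability;
this is the notion of "R is conditionally independent of W given V" for variables with
countable ranges. -/
def CondIndepOf {Ω 𝓡 V W : Type*} [MeasurableSpace Ω] [MeasurableSpace 𝓡]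
    (P : Measure Ω) (R : Ω → 𝓡) (Vf : Ω → V) (Wf : Ω → W) : Prop :=
  ∀ v w, 0 < P {ω | Vf ω = v ∧ Wf ω = w} →
    (P[|{ω | Vf ω = v ∧ Wf ω = w}]).map R = (P[|{ω | Vf ω = v}]).map R

lemma toReal_cond_apply {Ω : Type*} [MeasurableSpace Ω] (P : Measure Ω) {s : Set Ω}
    (hs : MeasurableSet s) (t : Set Ω) :
    ((P[|s]) t).toReal = P.real (s ∩ t) / P.real s := by
  rw [cond_apply hs, ENNReal.toReal_mul, ENNReal.toReal_inv, div_eq_inv_mul]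
  rfl

lemma integral_ite_one_zero {Ω : Type*} [MeasurableSpace Ω] (μ : Measure Ω)
    (p : Ω → Prop) [DecidablePred p] (hp : MeasurableSet {ω | p ω}) :
    ∫ ω, (if p ω then (1 : ℝ) else 0) ∂μ = μ.real {ω | p ω} := by
  rw [← integral_indicator_one hp]
  refine integral_congr_ae (Filter.Eventually.of_forall fun ω => ?_)
  simp [Set.indicator_apply]

lemma integrable_ite_one_zero {Ω : Type*} [MeasurableSpace Ω] (μ : Measure Ω)
    [IsFiniteMeasure μ] (p : Ω → Prop) [DecidablePred p] (hp : MeasurableSet {ω | p ω}) :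
    Integrable (fun ω => if p ω then (1 : ℝ) else 0) μ := by
  refine ((integrable_const (1 : ℝ)).indicator hp).congr
    (Filter.Eventually.of_forall fun ω => ?_)
  simp [Set.indicator_apply]

/-- Under conditional independence, the probability of `{R ∈ B}` on the cell `{V = v, W = w}`
factors through the law of `R` given `V = v`. -/
lemma CondIndepOf.measureReal_inter {Ω 𝓡 V W : Type*} [MeasurableSpace Ω] [MeasurableSpace 𝓡]
    {P : Measure Ω} [IsFiniteMeasure P] {R : Ω → 𝓡} {Vf : Ω → V} {Wf : Ω → W}
    (h : CondIndepOf P R Vf Wf) (hR : Measurable R) {v : V} {w : W}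
    (hvw : MeasurableSet {ω | Vf ω = v ∧ Wf ω = w})
    (hpos : 0 < P {ω | Vf ω = v ∧ Wf ω = w}) {B : Set 𝓡} (hB : MeasurableSet B) :
    P.real ({ω | Vf ω = v ∧ Wf ω = w} ∩ R ⁻¹' B) =
      P.real {ω | Vf ω = v ∧ Wf ω = w} * ((P[|{ω | Vf ω = v}]).map R B).toReal := by
  have hne : P.real {ω | Vf ω = v ∧ Wf ω = w} ≠ 0 :=
    (ENNReal.toReal_pos hpos.ne' (measure_ne_top _ _)).ne'
  rw [← h v w hpos, Measure.map_apply hR hB, toReal_cond_apply P hvw]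
  field_simp

/-- **Theorem (Identification as conditional moment with direct effects).**
With complete cases in the observational sample (no "no direct effect" assumption;
only stability across samples is imposed), the conditional moment
`E_{P_x}[Δ̃ᵉ(d) − μ(d,x)·Δ̃ᵒ(d) | σ(R)] = 0` holds `P_x`-a.s. -/
theorem statement3
    {Ω 𝓡 𝓧 : Type*} [MeasurableSpace Ω] [MeasurableSpace 𝓡] [StandardBorelSpace 𝓡]
    [MeasurableSpace 𝓧] [MeasurableSingletonClass 𝓧] [Countable 𝓧]
    (P : Measure Ω) [IsProbabilityMeasure P]
    (S : Ω → Sample) (D : Ω → Bool) (Y0 Y1 : Ω → Bool) (R : Ω → 𝓡) (X : Ω → 𝓧)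
    (hS : Measurable S) (hD : Measurable D) (hY0 : Measurable Y0) (hY1 : Measurable Y1)
    (hR : Measurable R) (hX : Measurable X)
    (Y : Ω → Bool) (hYdef : ∀ ω, Y ω = if D ω then Y1 ω else Y0 ω)
    (x : 𝓧) (hx : 0 < P {ω | X ω = x})
    -- Randomization: D ⫫ (Y(0), Y(1)) under P(·|S = e, X = x)
    (randomization :
      IndepFun D (fun ω => (Y0 ω, Y1 ω)) (P[|{ω | S ω = Sample.e ∧ X ω = x}]))
    -- Positivity (complete cases: treatment varies in the observational sample too)
    (positivity_e : ∀ d y : Bool,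
      0 < P {ω | S ω = Sample.e ∧ X ω = x ∧ D ω = d ∧ Y ω = y})
    (positivity_o : ∀ d y : Bool,
      0 < P {ω | S ω = Sample.o ∧ X ω = x ∧ D ω = d ∧ Y ω = y})
    -- Stability: R ⫫ S | (X, D, Y)
    (stability : CondIndepOf P R (fun ω => (X ω, D ω, Y ω)) S)
    (d : Bool)
    -- μ(d, x) := E[Y(d) | S = e, X = x]
    (μdx : ℝ)
    (hμdx : μdx = ∫ ω, b2r (if d then Y1 ω else Y0 ω)
        ∂(P[|{ω | S ω = Sample.e ∧ X ω = x}]))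
    -- Δ̃ᵉ(d) := 1{D=d,S=e}/P(D=d,S=e|X=x) − 1{Y=0,D=d,S=o}/P(Y=0,D=d,S=o|X=x)
    (Δte : Ω → ℝ)
    (hΔte : ∀ ω, Δte ω =
      (if D ω = d ∧ S ω = Sample.e then (1 : ℝ) else 0) /
        ((P[|{ω' | X ω' = x}]) {ω' | D ω' = d ∧ S ω' = Sample.e}).toReal -
      (if Y ω = false ∧ D ω = d ∧ S ω = Sample.o then (1 : ℝ) else 0) /
        ((P[|{ω' | X ω' = x}])
          {ω' | Y ω' = false ∧ D ω' = d ∧ S ω' = Sample.o}).toReal)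
    -- Δ̃ᵒ(d) := 1{Y=1,D=d,S=o}/P(Y=1,D=d,S=o|X=x) − 1{Y=0,D=d,S=o}/P(Y=0,D=d,S=o|X=x)
    (Δto : Ω → ℝ)
    (hΔto : ∀ ω, Δto ω =
      (if Y ω = true ∧ D ω = d ∧ S ω = Sample.o then (1 : ℝ) else 0) /
        ((P[|{ω' | X ω' = x}])
          {ω' | Y ω' = true ∧ D ω' = d ∧ S ω' = Sample.o}).toReal -
      (if Y ω = false ∧ D ω = d ∧ S ω = Sample.o then (1 : ℝ) else 0) /
        ((P[|{ω' | X ω' = x}])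
          {ω' | Y ω' = false ∧ D ω' = d ∧ S ω' = Sample.o}).toReal) :
    (P[|{ω | X ω = x}])[(fun ω => Δte ω - μdx * Δto ω) |
        MeasurableSpace.comap R inferInstance]
      =ᵐ[P[|{ω | X ω = x}]] 0 := by
  have hY : Measurable Y := by
    rw [funext hYdef]
    exact Measurable.ite (hD (measurableSet_singleton true)) hY1 hY0
  have mX : MeasurableSet {ω | X ω = x} := hX (measurableSet_singleton x)
  have mS : ∀ s, MeasurableSet {ω | S ω = s} := fun s => measurableSet_preimage hS (t := {s}) trivial
  have mD : MeasurableSet {ω | D ω = d} := hD (measurableSet_singleton d)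
  have mY : ∀ y, MeasurableSet {ω | Y ω = y} := fun y => hY (measurableSet_singleton y)
  have mSX : MeasurableSet {ω | S ω = Sample.e ∧ X ω = x} := (mS _).inter mX
  have mDS : MeasurableSet {ω | D ω = d ∧ S ω = Sample.e} := mD.inter (mS _)
  have mYDS : ∀ y, MeasurableSet {ω | Y ω = y ∧ D ω = d ∧ S ω = Sample.o} :=
    fun y => (mY y).inter (mD.inter (mS _))
  have : IsProbabilityMeasure (P[|{ω | X ω = x}]) := cond_isProbabilityMeasure hx.ne'
  set c : Sample → Bool → Set Ω :=
    fun s y => {ω | S ω = s ∧ X ω = x ∧ D ω = d ∧ Y ω = y} with hc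
  have mc : ∀ s y, MeasurableSet (c s y) := fun s y =>
    (mS s).inter (mX.inter (mD.inter (mY y)))
  have hcpos : ∀ s y, 0 < P (c s y) := by
    rintro (_ | _) y
    · exact positivity_e d y
    · exact positivity_o d y
  have hppos : ∀ s y, 0 < P.real (c s y) := fun s y =>
    ENNReal.toReal_pos (hcpos s y).ne' (measure_ne_top _ _)
  have hxpos : 0 < P.real {ω | X ω = x} := ENNReal.toReal_pos hx.ne' (measure_ne_top _ _)
  have hdisj : Disjoint (c Sample.e false) (c Sample.e true) := by
    rw [Set.disjoint_left]
    rintro ω ⟨-, -, -, h0⟩ ⟨-, -, -, h1⟩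
    simp [h0] at h1
  have hcell_e : {ω | X ω = x} ∩ {ω | D ω = d ∧ S ω = Sample.e} =
      c Sample.e false ∪ c Sample.e true := by
    ext ω
    cases h : Y ω <;> simp [hc, h] <;> tauto
  have hcell_o : ∀ y, {ω | X ω = x} ∩ {ω | Y ω = y ∧ D ω = d ∧ S ω = Sample.o} =
      c Sample.o y := by
    intro y
    ext ω
    simp only [hc, Set.mem_inter_iff, Set.mem_ofPred_eq]
    tauto
  have hμ : μdx = P.real (c Sample.e true) /
      (P.real (c Sample.e false) + P.real (c Sample.e true)) := by
    have hYd : Measurable fun ω => if d then Y1 ω else Y0 ω := by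
      cases d <;> simpa
    have hint : μdx = (P[|{ω | S ω = Sample.e ∧ X ω = x}]).real
        {ω | (if d then Y1 ω else Y0 ω) = true} := by
      rw [hμdx]
      exact integral_ite_one_zero _ _ (hYd (measurableSet_singleton true))
    have hind : IndepFun D (fun ω => if d then Y1 ω else Y0 ω)
        (P[|{ω | S ω = Sample.e ∧ X ω = x}]) :=
      randomization.comp (φ := id) (ψ := fun q : Bool × Bool => if d then q.2 else q.1)
        measurable_id (measurable_of_countable _)
    have hmul := congrArg ENNReal.toReal (hind.measure_inter_preimage_eq_mul _ _
      (measurableSet_singleton d) (measurableSet_singleton true))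
    have h1 : {ω | S ω = Sample.e ∧ X ω = x} ∩
        (D ⁻¹' {d} ∩ (fun ω => if d then Y1 ω else Y0 ω) ⁻¹' {true}) = c Sample.e true := by
      ext ω
      simp only [hc, Set.mem_inter_iff, Set.mem_ofPred_eq, Set.mem_preimage,
        Set.mem_singleton_iff, hYdef]
      constructor
      · rintro ⟨⟨h1, h2⟩, h3, h4⟩
        exact ⟨h1, h2, h3, by rwa [h3]⟩
      · rintro ⟨h1, h2, h3, h4⟩
        exact ⟨⟨h1, h2⟩, h3, by rwa [h3] at h4⟩
    have h2 : {ω | S ω = Sample.e ∧ X ω = x} ∩ D ⁻¹' {d} =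
        c Sample.e false ∪ c Sample.e true := by
      rw [← hcell_e]
      ext ω
      simp only [Set.mem_inter_iff, Set.mem_ofPred_eq, Set.mem_preimage, Set.mem_singleton_iff]
      tauto
    have hSX : 0 < P.real {ω | S ω = Sample.e ∧ X ω = x} :=
      (hppos Sample.e true).trans_le (measureReal_mono fun ω h => ⟨h.1, h.2.1⟩)
    rw [ENNReal.toReal_mul, toReal_cond_apply P mSX, toReal_cond_apply P mSX, h1, h2] at hmul
    change _ = _ * (P[|{ω | S ω = Sample.e ∧ X ω = x}]).real
        {ω | (if d then Y1 ω else Y0 ω) = true} at hmul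
    rw [← hint, measureReal_union hdisj (mc _ _)] at hmul
    have := hppos Sample.e false
    have := hppos Sample.e true
    rw [eq_div_iff (by positivity)]
    field_simp at hmul
    linarith
  have hint_e := integrable_ite_one_zero (P[|{ω | X ω = x}]) _ mDS
  have hint_o := fun y => integrable_ite_one_zero (P[|{ω | X ω = x}]) _ (mYDS y)
  have hinte : Integrable Δte (P[|{ω | X ω = x}]) := by
    rw [funext hΔte]
    exact (hint_e.div_const _).sub ((hint_o false).div_const _)
  have hinto : Integrable Δto (P[|{ω | X ω = x}]) := by
    rw [funext hΔto]
    exact ((hint_o true).div_const _).sub ((hint_o false).div_const _)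
  refine (ae_eq_condExp_of_forall_setIntegral_eq hR.comap_le (hinte.sub (hinto.const_mul μdx))
    (fun _ _ _ => integrableOn_zero) ?_ aestronglyMeasurable_zero).symm
  rintro _ ⟨B, hB, rfl⟩ -
  obtain ⟨k, hk⟩ : ∃ k : Bool → ℝ, ∀ s y,
      P.real (c s y ∩ R ⁻¹' B) = P.real (c s y) * k y := by
    refine ⟨fun y => ((P[|{ω | (X ω, D ω, Y ω) = (x, d, y)}]).map R B).toReal, fun s y => ?_⟩
    have hcs : c s y = {ω | (X ω, D ω, Y ω) = (x, d, y) ∧ S ω = s} := by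
      ext ω
      simp only [hc, Set.mem_ofPred_eq, Prod.mk.injEq]
      tauto
    have hm := mc s y
    have hp := hcpos s y
    rw [hcs] at hm hp ⊢
    exact stability.measureReal_inter hR hm hp hB
  have hrestr : ∀ T : Set Ω, MeasurableSet T →
      ((P[|{ω | X ω = x}]).restrict (R ⁻¹' B)).real T =
        P.real (({ω | X ω = x} ∩ T) ∩ R ⁻¹' B) / P.real {ω | X ω = x} := by
    intro T hT
    rw [measureReal_restrict_apply hT, Set.inter_assoc]
    exact toReal_cond_apply P mX _
  have hie : ∫ ω in R ⁻¹' B, Δte ω ∂(P[|{ω | X ω = x}]) = μdx * (k true - k false) := by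
    simp_rw [hΔte]
    rw [integral_sub (hint_e.div_const _).integrableOn ((hint_o false).div_const _).integrableOn,
      integral_div, integral_div, integral_ite_one_zero _ _ mDS,
      integral_ite_one_zero _ _ (mYDS false), hrestr _ mDS, hrestr _ (mYDS false),
      toReal_cond_apply P mX, toReal_cond_apply P mX, hcell_e, hcell_o, Set.union_inter_distrib_right,
      measureReal_union (hdisj.mono Set.inter_subset_left Set.inter_subset_left)
        ((mc _ _).inter (hR hB)),
      measureReal_union hdisj (mc _ _), hk, hk, hk, hμ]
    have := hppos Sample.e false
    have := hppos Sample.e true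
    have := hppos Sample.o false
    field_simp
    ring
  have hio : ∫ ω in R ⁻¹' B, Δto ω ∂(P[|{ω | X ω = x}]) = k true - k false := by
    simp_rw [hΔto]
    rw [integral_sub ((hint_o true).div_const _).integrableOn
        ((hint_o false).div_const _).integrableOn,
      integral_div, integral_div, integral_ite_one_zero _ _ (mYDS true),
      integral_ite_one_zero _ _ (mYDS false), hrestr _ (mYDS true), hrestr _ (mYDS false),
      toReal_cond_apply P mX, toReal_cond_apply P mX, hcell_o, hcell_o, hk, hk]
    have := hppos Sample.o true
    have := hppos Sample.o false
    field_simp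
  simp_rw [Pi.sub_apply]
  rw [integral_sub hinte.integrableOn (hinto.const_mul μdx).integrableOn, integral_const_mul,
    hie, hio]
  simp
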